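/- Let S be a finite nonempty set of states, let the action space A be a real normed vector space, and let γ ∈ [0,1). Let d₀ : S → ℝ be a probability mass function on S. Let P assign to each state s' ∈ S and action a ∈ A a probability mass function P(·|s',a) on S, and assume the Lipschitz condition: for all s' ∈ S and a₁, a₂ ∈ A, Σ_{s∈S} |P(s|s',a₁) − P(s|s',a₂)| ≤ K_P·‖a₁ − a₂‖ for some constant K_P ≥ 0. Let π₁, π₂ : S → A be deterministic policies with ‖π₁(s) − π₂(s)‖ ≤ ε for all s ∈ S, where ε ≥ 0. Suppose d¹, d² : S → ℝ are nonnegative functions, each summing to 1 over S, satisfying the Bellman flow equations dⁱ(s) = (1−γ)·d₀(s) + γ·Σ_{s'∈S} P(s|s', πᵢ(s'))·dⁱ(s') for all s ∈ S and i ∈ {1,2}. Then (1/2)·Σ_{s∈S} |d¹(s) − d²(s)| ≤ γ·K_P·ε / (2(1−γ)). -/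

import Mathlib

open Finset

/-- A finite kernel acts on `ℓ¹` with norm at most the largest `ℓ¹` norm of its rows. -/
theorem sum_abs_sum_mul_le {ι κ : Type*} [Fintype ι] [Fintype κ]
    (Q : ι → κ → ℝ) (x : ι → ℝ) {C : ℝ} (hQ : ∀ i, ∑ j, |Q i j| ≤ C) :
    ∑ j, |∑ i, Q i j * x i| ≤ C * ∑ i, |x i| :=
  calc ∑ j, |∑ i, Q i j * x i|
      ≤ ∑ j, ∑ i, |Q i j| * |x i| := by
        gcongr with j
        simpa only [abs_mul] using abs_sum_le_sum_abs (fun i => Q i j * x i) univ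
    _ = ∑ i, (∑ j, |Q i j|) * |x i| := by
        rw [sum_comm]
        simp only [sum_mul]
    _ ≤ C * ∑ i, |x i| := by
        rw [mul_sum]
        gcongr with i
        exact hQ i

/-- **Bounded distribution shift between state occupancy measures of nearby policies.**
In a finite MDP with discount `γ ∈ [0,1)`, initial distribution `d₀`, and transition
kernel `P` that is `K_P`-Lipschitz in the action (in total variation), if two
deterministic policies `π₁, π₂` satisfy `‖π₁ s - π₂ s‖ ≤ ε` everywhere, then the total
variation distance between their state occupancy measures `d¹, d²` (nonnegative,
summing to one, and satisfying the Bellman flow equations) is at most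
`γ K_P ε / (2 (1 - γ))`. -/
theorem tv_occupancy_le_of_close_policies
    {S : Type*} [Fintype S] [Nonempty S]
    {A : Type*} [NormedAddCommGroup A] [NormedSpace ℝ A]
    {γ : ℝ} (hγ0 : 0 ≤ γ) (hγ1 : γ < 1)
    (d₀ : S → ℝ) (hd₀0 : ∀ s, 0 ≤ d₀ s) (hd₀1 : ∑ s, d₀ s = 1)
    (P : S → A → S → ℝ)
    (hP0 : ∀ s' a s, 0 ≤ P s' a s) (hP1 : ∀ s' a, ∑ s, P s' a s = 1)
    {K_P : ℝ} (hK : 0 ≤ K_P)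
    (hLip : ∀ s' (a₁ a₂ : A), ∑ s, |P s' a₁ s - P s' a₂ s| ≤ K_P * ‖a₁ - a₂‖)
    (π₁ π₂ : S → A) {ε : ℝ} (hε : 0 ≤ ε) (hπ : ∀ s, ‖π₁ s - π₂ s‖ ≤ ε)
    (d₁ d₂ : S → ℝ)
    (hd₁0 : ∀ s, 0 ≤ d₁ s) (hd₁1 : ∑ s, d₁ s = 1)
    (hd₂0 : ∀ s, 0 ≤ d₂ s) (hd₂1 : ∑ s, d₂ s = 1)
    (hflow₁ : ∀ s, d₁ s = (1 - γ) * d₀ s + γ * ∑ s', P s' (π₁ s') s * d₁ s')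
    (hflow₂ : ∀ s, d₂ s = (1 - γ) * d₀ s + γ * ∑ s', P s' (π₂ s') s * d₂ s') :
    (1 / 2) * ∑ s, |d₁ s - d₂ s| ≤ γ * K_P * ε / (2 * (1 - γ)) := by
  have hpolicy : ∑ s, |∑ s', (P s' (π₁ s') s - P s' (π₂ s') s) * d₁ s'| ≤ K_P * ε := by
    have h := sum_abs_sum_mul_le (fun s' s => P s' (π₁ s') s - P s' (π₂ s') s) d₁
      (fun s' => (hLip s' _ _).trans (mul_le_mul_of_nonneg_left (hπ s') hK))
    simpa only [abs_of_nonneg (hd₁0 _), hd₁1, mul_one] using h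
  have hcontract : ∑ s, |∑ s', P s' (π₂ s') s * (d₁ s' - d₂ s')| ≤ ∑ s, |d₁ s - d₂ s| := by
    have h := sum_abs_sum_mul_le (fun s' s => P s' (π₂ s') s) (fun s => d₁ s - d₂ s) (C := 1)
      (fun s' => by simp only [abs_of_nonneg (hP0 _ _ _), hP1, le_refl])
    simpa only [one_mul] using h
  have hdiff : ∀ s, d₁ s - d₂ s =
      γ * (∑ s', (P s' (π₁ s') s - P s' (π₂ s') s) * d₁ s' +
        ∑ s', P s' (π₂ s') s * (d₁ s' - d₂ s')) := by
    intro s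
    rw [hflow₁ s, hflow₂ s]
    simp only [sub_mul, mul_sub, sum_sub_distrib]
    ring
  have hrec : ∑ s, |d₁ s - d₂ s| ≤ γ * (K_P * ε + ∑ s, |d₁ s - d₂ s|) :=
    calc ∑ s, |d₁ s - d₂ s|
        ≤ ∑ s, γ * (|∑ s', (P s' (π₁ s') s - P s' (π₂ s') s) * d₁ s'| +
            |∑ s', P s' (π₂ s') s * (d₁ s' - d₂ s')|) := by
          refine sum_le_sum fun s _ => ?_
          rw [hdiff s, abs_mul, abs_of_nonneg hγ0]
          exact mul_le_mul_of_nonneg_left (abs_add_le _ _) hγ0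
      _ ≤ γ * (K_P * ε + ∑ s, |d₁ s - d₂ s|) := by
          rw [← mul_sum, sum_add_distrib]
          exact mul_le_mul_of_nonneg_left (add_le_add hpolicy hcontract) hγ0
  rw [le_div_iff₀ (by linarith)]
  linarith
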